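/- arXiv:0705.3370 — 6 statements merged into one kernel-verified Lean document; each statement's English description precedes it below -/
import Mathlib

section
/- Consider the scalar differential equation ż = −φ(t, z) + u(t) + η(t) with z(0) = z₀ ∈ [z_min, z_max] ⊂ ℝ, and let z : [0,∞) → ℝ be a solution defined for all t ≥ 0. Assume: (1) φ(t, z)·z ≥ 0 and φ_min ≤ ∂φ(t,z)/∂z ≤ φ_max for all t, z, with φ_min, φ_max > 0; (2) u is C¹ and bounded with ‖u‖_{∞,[0,∞]} ≤ u_∞ and ‖u̇‖_{∞,[0,∞]} ≤ ∂u_∞; (3) η ∈ L_∞[0,∞] with ‖η‖_{∞,[0,∞]} ≤ Δ; (4) there exist constants L, δ > 0 such that ∫_t^{t+L} |u(τ)| dτ ≥ δ for all t ≥ 0; (5) (δ/L)² − Δ·u_∞ > 0. Then for any p > 0 there exist constants L* > 0 and δ* ≥ (1/p)(δ²/L − Δ·u_∞·L) such that ∫_t^{t+L*} |z(τ)| dτ ≥ δ* ≥ (1/p)(δ²/L − Δ·u_∞·L) for all t ≥ 0. -/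
theorem pe_zero {f : ℝ → ℝ} (hf : Differentiable ℝ f) (h : ∀ w, 0 ≤ f w * w) : f 0 = 0 := by
  apply le_antisymm
  · refine le_of_tendsto (hf.continuous.continuousWithinAt (s := Set.Iio 0) (x := 0)).tendsto ?_
    filter_upwards [self_mem_nhdsWithin] with w hw
    by_contra! h1
    exact absurd (h w) (not_le.2 (mul_neg_of_pos_of_neg h1 hw))
  · refine ge_of_tendsto (hf.continuous.continuousWithinAt (s := Set.Ioi 0) (x := 0)).tendsto ?_
    filter_upwards [self_mem_nhdsWithin] with w hw
    by_contra! h1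
    exact absurd (h w) (not_le.2 (mul_neg_of_neg_of_pos h1 hw))

/-- Lemma 1 of the paper (filtered persistent-excitation lemma).
Consider `ż = -φ(t,z) + u(t) + η(t)`, `z(0) ∈ [z_min, z_max]`, where
(1) `φ(t,z)z ≥ 0` and `φ_min ≤ ∂φ/∂z ≤ φ_max` with `φ_min, φ_max > 0`;
(2) `u` is `C¹` and bounded, `‖u‖_∞ ≤ u_∞`, `‖u̇‖_∞ ≤ ∂u_∞`;
(3) `η` is essentially bounded, `‖η‖_∞ ≤ Δ`;
(4) `∫_t^{t+L} |u| ≥ δ` for all `t ≥ 0`;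
(5) `(δ/L)² - Δ·u_∞ > 0`.
Then for any `p > 0` there exist `L* > 0` and
`δ* ≥ (1/p)(δ²/L - Δ·u_∞·L)` with `∫_t^{t+L*} |z| ≥ δ*` for all `t ≥ 0`. -/
theorem filtered_persistent_excitation
    (φ : ℝ → ℝ → ℝ) (z u u' η : ℝ → ℝ)
    (zmin zmax φmin φmax uInf duInf Δ L δ : ℝ)
    (hφmin : 0 < φmin) (hφmax : 0 < φmax)
    (hz0 : z 0 ∈ Set.Icc zmin zmax)
    (hφsign : ∀ t w : ℝ, 0 ≤ φ t w * w)
    (hφdiff : ∀ t : ℝ, Differentiable ℝ (φ t))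
    (hφ' : ∀ t w : ℝ, φmin ≤ deriv (φ t) w ∧ deriv (φ t) w ≤ φmax)
    (hud : ∀ t ≥ (0:ℝ), HasDerivWithinAt u (u' t) (Set.Ici 0) t)
    (hu'c : ContinuousOn u' (Set.Ici 0))
    (hub : ∀ t ≥ (0:ℝ), |u t| ≤ uInf)
    (hu'b : ∀ t ≥ (0:ℝ), |u' t| ≤ duInf)
    (hηm : Measurable η) (hηb : ∀ t ≥ (0:ℝ), |η t| ≤ Δ)
    (hL : 0 < L) (hδ : 0 < δ)
    (hpe : ∀ t ≥ (0:ℝ), δ ≤ ∫ τ in t..(t + L), |u τ|)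
    (hcond : 0 < (δ / L) ^ 2 - Δ * uInf)
    (hzd : ∀ t ≥ (0:ℝ), HasDerivWithinAt z (-(φ t (z t)) + u t + η t) (Set.Ici 0) t) :
    ∀ p > (0:ℝ), ∃ Lstar > (0:ℝ), ∃ δstar : ℝ,
      (1 / p) * (δ ^ 2 / L - Δ * uInf * L) ≤ δstar ∧
      ∀ t ≥ (0:ℝ), δstar ≤ ∫ τ in t..(t + Lstar), |z τ| := by
  have hU : 0 ≤ uInf := (abs_nonneg _).trans (hub 0 le_rfl)
  have hD : 0 ≤ duInf := (abs_nonneg _).trans (hu'b 0 le_rfl)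
  have hΔ : 0 ≤ Δ := (abs_nonneg _).trans (hηb 0 le_rfl)
  have hzc : ContinuousOn z (Set.Ici 0) := fun t ht => (hzd t ht).continuousWithinAt
  have huc : ContinuousOn u (Set.Ici 0) := fun t ht => (hud t ht).continuousWithinAt
  have hφ0 : ∀ t, φ t 0 = 0 := fun t => pe_zero (hφdiff t) (hφsign t)
  have hφlow : ∀ t w, φmin * w ^ 2 ≤ φ t w * w := by
    intro t w
    rcases le_total 0 w with hw | hw
    · have := mul_sub_le_image_sub_of_le_deriv (hφdiff t) (fun w => (hφ' t w).1) hw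
      rw [hφ0] at this
      nlinarith
    · have := mul_sub_le_image_sub_of_le_deriv (hφdiff t) (fun w => (hφ' t w).1) hw
      rw [hφ0] at this
      nlinarith
  have hφup : ∀ t w, |φ t w| ≤ φmax * |w| := by
    intro t w
    have h1 := hφlow t w
    rcases le_total 0 w with hw | hw
    · have h2 := image_sub_le_mul_sub_of_deriv_le (hφdiff t) (fun w => (hφ' t w).2) hw
      have h3 := mul_sub_le_image_sub_of_le_deriv (hφdiff t) (fun w => (hφ' t w).1) hw
      rw [hφ0] at h2 h3
      rw [abs_of_nonneg hw, abs_of_nonneg (by nlinarith)]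
      linarith
    · have h2 := image_sub_le_mul_sub_of_deriv_le (hφdiff t) (fun w => (hφ' t w).2) hw
      have h3 := mul_sub_le_image_sub_of_le_deriv (hφdiff t) (fun w => (hφ' t w).1) hw
      rw [hφ0] at h2 h3
      rw [abs_of_nonpos hw, abs_of_nonpos (by nlinarith)]
      linarith
  obtain ⟨M, hM0, hMz, hMφ⟩ : ∃ M, 0 < M ∧ |z 0| ≤ M ∧ uInf + Δ < φmin * M := by
    refine ⟨|z 0| + (uInf + Δ) / φmin + 1, by positivity, ?_, ?_⟩
    · have : 0 ≤ (uInf + Δ) / φmin := by positivity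
      linarith
    · have : φmin * (|z 0| + (uInf + Δ) / φmin + 1) = φmin * |z 0| + (uInf + Δ) + φmin := by
        field_simp
      rw [this]
      have := mul_nonneg hφmin.le (abs_nonneg (z 0))
      linarith
  have hzM : ∀ t ≥ (0:ℝ), |z t| ≤ M := by
    intro t ht
    have key := image_le_of_deriv_right_lt_deriv_boundary' (f := fun s => z s ^ 2)
      (f' := fun s => 2 * z s * (-(φ s (z s)) + u s + η s)) (a := 0) (b := t)
      (B := fun _ => M ^ 2) (B' := fun _ => 0)
      ((hzc.mono Set.Icc_subset_Ici_self).pow 2)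
      (fun x hx => by
        have := ((hzd x hx.1).mono (Set.Ici_subset_Ici.2 hx.1)).fun_pow 2
        simpa using this)
      (sq_le_sq' (by linarith [neg_abs_le (z 0)]) (by linarith [le_abs_self (z 0)]))
      continuousOn_const (fun x _ => hasDerivWithinAt_const _ _ _)
      (fun x hx he => by
        have h1 := hφlow x (z x)
        have he' : |z x| = M := by
          have := (sq_eq_sq_iff_abs_eq_abs _ _).1 he
          rwa [abs_of_pos hM0] at this
        have h2 : z x * (u x + η x) ≤ M * (uInf + Δ) := by
          calc _ ≤ |z x * (u x + η x)| := le_abs_self _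
            _ = |z x| * |u x + η x| := abs_mul _ _
            _ ≤ _ := by
              rw [he']
              gcongr
              exact (abs_add_le _ _).trans (add_le_add (hub x hx.1) (hηb x hx.1))
        have he : z x ^ 2 = M ^ 2 := he
        rw [he] at h1
        nlinarith)
      (Set.right_mem_Icc.2 ht)
    exact abs_le_of_sq_le_sq key hM0.le
  obtain ⟨C, hC⟩ : ∃ C, C = duInf + φmax * uInf := ⟨_, rfl⟩
  have hC0 : 0 ≤ C := by rw [hC]; positivity
  obtain ⟨c, hc⟩ : ∃ c, c = δ ^ 2 / L - Δ * uInf * L := ⟨_, rfl⟩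
  have hcpos : 0 < c := by
    have : c = L * ((δ / L) ^ 2 - Δ * uInf) := by rw [hc]; field_simp
    rw [this]; positivity
  have hzi : ∀ a ≥ (0:ℝ), ∀ b ≥ (0:ℝ), IntervalIntegrable (fun s => |z s|) MeasureTheory.volume a b :=
    fun a ha b hb => ((hzc.abs).mono (fun x hx => (le_inf ha hb).trans hx.1)).intervalIntegrable
  have hui : ∀ a ≥ (0:ℝ), ∀ b ≥ (0:ℝ), IntervalIntegrable (fun s => |u s|) MeasureTheory.volume a b :=
    fun a ha b hb => ((huc.abs).mono (fun x hx => (le_inf ha hb).trans hx.1)).intervalIntegrable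
  have step : ∀ a ≥ (0:ℝ), c - C * ∫ s in a..(a + L), |z s| ≤ z (a + L) * u (a + L) - z a * u a := by
    intro a ha
    have haL : 0 ≤ a + L := by linarith
    have hI : IntervalIntegrable
        (fun s => (2 * (δ / L) * |u s| - ((δ / L) ^ 2 + Δ * uInf)) - C * |z s|)
        MeasureTheory.volume a (a + L) :=
      (((hui a ha _ haL).const_mul _).sub intervalIntegrable_const).sub
        ((hzi a ha _ haL).const_mul _)
    have key := intervalIntegral.integral_le_sub_of_hasDeriv_right_of_le
      (g := fun s => z s * u s)
      (g' := fun s => (-(φ s (z s)) + u s + η s) * u s + z s * u' s)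
      (φ := fun s => (2 * (δ / L) * |u s| - ((δ / L) ^ 2 + Δ * uInf)) - C * |z s|)
      (a := a) (b := a + L) (by linarith)
      ((hzc.mul huc).mono (fun x hx => ha.trans hx.1))
      (fun x hx => by
        have hx0 : 0 ≤ x := ha.trans hx.1.le
        exact ((hzd x hx0).mul (hud x hx0)).mono (fun y hy => hx0.trans (le_of_lt hy)))
      ((intervalIntegrable_iff_integrableOn_Icc_of_le (by linarith)).1 hI)
      (fun x hx => by
        have hx0 : 0 ≤ x := ha.trans hx.1.le
        have h1 : |φ x (z x) * u x| ≤ φmax * |z x| * uInf := by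
          rw [abs_mul]
          exact mul_le_mul (hφup _ _) (hub x hx0) (abs_nonneg _) (by positivity)
        have h2 : |η x * u x| ≤ Δ * uInf := by
          rw [abs_mul]
          exact mul_le_mul (hηb x hx0) (hub x hx0) (abs_nonneg _) hΔ
        have h3 : |z x * u' x| ≤ |z x| * duInf := by
          rw [abs_mul]
          exact mul_le_mul_of_nonneg_left (hu'b x hx0) (abs_nonneg _)
        have h4 := sq_nonneg (|u x| - δ / L)
        have h5 := sq_abs (u x)
        have h1' := (abs_le.1 h1).2
        have h2' := (abs_le.1 h2).1
        have h3' := (abs_le.1 h3).1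
        show _ ≤ (-(φ x (z x)) + u x + η x) * u x + z x * u' x
        rw [hC]
        nlinarith)
    rw [intervalIntegral.integral_sub
        (((hui a ha _ haL).const_mul _).sub intervalIntegrable_const)
        ((hzi a ha _ haL).const_mul _),
      intervalIntegral.integral_sub ((hui a ha _ haL).const_mul _) intervalIntegrable_const,
      intervalIntegral.integral_const_mul, intervalIntegral.integral_const_mul,
      intervalIntegral.integral_const] at key
    refine le_trans ?_ key
    have h1 : 2 * (δ / L) * δ ≤ 2 * (δ / L) * ∫ s in a..(a + L), |u s| :=
      mul_le_mul_of_nonneg_left (hpe a ha) (by positivity)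
    have h2 : c = 2 * (δ / L) * δ - (a + L - a) • ((δ / L) ^ 2 + Δ * uInf) := by
      rw [hc, smul_eq_mul]; field_simp; ring
    linarith
  have hn : ∀ n : ℕ, ∀ t ≥ (0:ℝ),
      n * c - C * ∫ s in t..(t + n * L), |z s| ≤ z (t + n * L) * u (t + n * L) - z t * u t := by
    intro n t ht
    induction n with
    | zero => simp
    | succ k ih =>
      have hk : 0 ≤ t + k * L := by positivity
      have h1 := step (t + k * L) hk
      have h2 := intervalIntegral.integral_add_adjacent_intervals
        (hzi t ht _ hk) (hzi _ hk (t + k * L + L) (by linarith))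
      have h3 : t + ((k + 1 : ℕ) : ℝ) * L = t + k * L + L := by push_cast; ring
      rw [h3, ← h2]
      push_cast
      linarith
  intro p hp
  obtain ⟨n, hnn⟩ := exists_nat_gt (((C + 1) * ((1 / p) * c) + 2 * (M * uInf)) / c)
  have hnpos : (0:ℝ) < n := lt_of_le_of_lt (by positivity) hnn
  rw [div_lt_iff₀ hcpos] at hnn
  refine ⟨n * L, by positivity, (1 / p) * c, by rw [hc], ?_⟩
  intro t ht
  have h1 := hn n t ht
  have hzu : ∀ s ≥ (0:ℝ), |z s * u s| ≤ M * uInf := fun s hs => by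
    rw [abs_mul]
    exact mul_le_mul (hzM s hs) (hub s hs) (abs_nonneg _) hM0.le
  have h2 := (abs_le.1 (hzu t ht)).1
  have h3 := (abs_le.1 (hzu (t + n * L) (by positivity))).2
  have h4 : 0 ≤ ∫ s in t..(t + n * L), |z s| :=
    intervalIntegral.integral_nonneg (by linarith [mul_pos hnpos hL]) (fun _ _ => abs_nonneg _)
  by_contra! hlt
  nlinarith
end

section
/- Let g : [0,∞) → ℝ be continuous, and let x, y : [0,∞) → ℝ be differentiable functions satisfying ẋ(t) = g(t)(x(t) − y(t) − x(t)(x(t)² + y(t)²)) and ẏ(t) = g(t)(x(t) + y(t) − y(t)(x(t)² + y(t)²)) for all t ≥ 0. If x(0)² + y(0)² = 1, then x(t)² + y(t)² = 1 for all t ≥ 0. -/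
/-- Invariance of the unit circle for the planar oscillator subsystem
`ẋ = g(t)(x - y - x(x²+y²))`, `ẏ = g(t)(x + y - y(x²+y²))`:
if `x(0)² + y(0)² = 1` then `x(t)² + y(t)² = 1` for all `t ≥ 0`. -/
theorem oscillator_circle_invariant
    (g x y : ℝ → ℝ)
    (hg : ContinuousOn g (Set.Ici 0))
    (hx : ∀ t ≥ (0:ℝ), HasDerivWithinAt x
      (g t * (x t - y t - x t * ((x t) ^ 2 + (y t) ^ 2))) (Set.Ici 0) t)
    (hy : ∀ t ≥ (0:ℝ), HasDerivWithinAt y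
      (g t * (x t + y t - y t * ((x t) ^ 2 + (y t) ^ 2))) (Set.Ici 0) t)
    (h0 : (x 0) ^ 2 + (y 0) ^ 2 = 1) :
    ∀ t ≥ (0:ℝ), (x t) ^ 2 + (y t) ^ 2 = 1 := by
  intro T hT
  have hxc : ContinuousOn x (Set.Ici 0) := fun t ht => (hx t ht).continuousWithinAt
  have hyc : ContinuousOn y (Set.Ici 0) := fun t ht => (hy t ht).continuousWithinAt
  have hsub : Set.Icc 0 T ⊆ Set.Ici (0:ℝ) := fun t ht => ht.1
  have hc : ContinuousOn (fun t => -2 * g t * ((x t) ^ 2 + (y t) ^ 2)) (Set.Icc 0 T) :=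
    ((continuousOn_const.mul hg).mul ((hxc.pow 2).add (hyc.pow 2))).mono hsub
  obtain ⟨K, hK⟩ := isCompact_Icc.exists_bound_of_continuousOn hc
  have hfc : ContinuousOn (fun t => (x t) ^ 2 + (y t) ^ 2 - 1) (Set.Icc 0 T) :=
    (((hxc.pow 2).add (hyc.pow 2)).sub continuousOn_const).mono hsub
  have key := eq_zero_of_abs_deriv_le_mul_abs_self_of_eq_zero_right
    (f := fun t => (x t) ^ 2 + (y t) ^ 2 - 1)
    (f' := fun t => (-2 * g t * ((x t) ^ 2 + (y t) ^ 2)) * ((x t) ^ 2 + (y t) ^ 2 - 1))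
    (K := K) (a := 0) (b := T) hfc
    (by
      intro t ht
      have h := ((((hx t ht.1).pow 2).add ((hy t ht.1).pow 2)).sub_const 1).mono
        (Set.Ici_subset_Ici.mpr ht.1)
      refine h.congr_deriv ?_
      push_cast
      ring)
    (by simp [h0])
    (by
      intro t ht
      rw [norm_mul]
      exact mul_le_mul_of_nonneg_right (hK t ⟨ht.1, ht.2.le⟩) (norm_nonneg _))
    T ⟨hT, le_rfl⟩
  have key' : (x T) ^ 2 + (y T) ^ 2 - 1 = 0 := key
  linarith
end

section
/- Let g : [0,∞) → ℝ be continuous and nonnegative, and let x, y : [0,∞) → ℝ be differentiable functions satisfying ẋ(t) = g(t)(x(t) − y(t) − x(t)(x(t)² + y(t)²)) and ẏ(t) = g(t)(x(t) + y(t) − y(t)(x(t)² + y(t)²)) for all t ≥ 0. Then for all t ≥ 0: x(t)² + y(t)² ≤ max{1, x(0)² + y(0)²}. In particular, sup_{t≥0} |x(t)| ≤ max{1, √(x(0)² + y(0)²)} and sup_{t≥0} |y(t)| ≤ max{1, √(x(0)² + y(0)²)}. -/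
/-- Boundedness estimate (eq. (45)) for the planar oscillator subsystem with
nonnegative phase rate `g`: `x(t)² + y(t)² ≤ max{1, x(0)² + y(0)²}` for all
`t ≥ 0`; in particular `|x(t)|` and `|y(t)|` are bounded by
`max{1, √(x(0)² + y(0)²)}`. -/
theorem oscillator_bounded
    (g x y : ℝ → ℝ)
    (hg : ContinuousOn g (Set.Ici 0))
    (hg0 : ∀ t ≥ (0:ℝ), 0 ≤ g t)
    (hx : ∀ t ≥ (0:ℝ), HasDerivWithinAt x
      (g t * (x t - y t - x t * ((x t) ^ 2 + (y t) ^ 2))) (Set.Ici 0) t)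
    (hy : ∀ t ≥ (0:ℝ), HasDerivWithinAt y
      (g t * (x t + y t - y t * ((x t) ^ 2 + (y t) ^ 2))) (Set.Ici 0) t) :
    (∀ t ≥ (0:ℝ), (x t) ^ 2 + (y t) ^ 2 ≤ max 1 ((x 0) ^ 2 + (y 0) ^ 2)) ∧
    (∀ t ≥ (0:ℝ), |x t| ≤ max 1 (Real.sqrt ((x 0) ^ 2 + (y 0) ^ 2))) ∧
    (∀ t ≥ (0:ℝ), |y t| ≤ max 1 (Real.sqrt ((x 0) ^ 2 + (y 0) ^ 2))) := by
  have key : ∀ t ≥ (0:ℝ), (x t) ^ 2 + (y t) ^ 2 ≤ max 1 ((x 0) ^ 2 + (y 0) ^ 2) := by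
    intro t ht
    set M := max 1 ((x 0) ^ 2 + (y 0) ^ 2) with hM
    have hM1 : 1 ≤ M := le_max_left _ _
    have hV : ∀ s ≥ (0:ℝ), HasDerivWithinAt (fun s => (x s) ^ 2 + (y s) ^ 2)
        (2 * g s * (((x s) ^ 2 + (y s) ^ 2) * (1 - ((x s) ^ 2 + (y s) ^ 2)))) (Set.Ici 0) s := by
      intro s hs
      have h := ((hx s hs).fun_pow 2).fun_add ((hy s hs).fun_pow 2)
      refine h.congr_deriv ?_
      norm_num
      ring
    refine le_of_forall_pos_le_add fun δ hδ => ?_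
    have hε : 0 < δ / (t + 1) := by positivity
    have hle : δ / (t + 1) * t ≤ δ := by
      rw [div_mul_eq_mul_div, div_le_iff₀ (by positivity)]
      nlinarith
    have := image_le_of_deriv_right_lt_deriv_boundary (a := 0) (b := t)
      (f := fun s => (x s) ^ 2 + (y s) ^ 2)
      (f' := fun s => 2 * g s * (((x s) ^ 2 + (y s) ^ 2) * (1 - ((x s) ^ 2 + (y s) ^ 2))))
      (B := fun s => M + δ / (t + 1) * s) (B' := fun _ => δ / (t + 1))
      (fun s hs => (hV s hs.1).continuousWithinAt.mono Set.Icc_subset_Ici_self)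
      (fun s hs => (hV s hs.1).mono (Set.Ici_subset_Ici.2 hs.1))
      (by simp [hM])
      (fun s => by simpa using ((hasDerivAt_id s).const_mul (δ / (t + 1))).const_add M)
      (by
        intro s hs he
        refine lt_of_le_of_lt ?_ hε
        have h0 : 0 ≤ δ / (t + 1) * s := mul_nonneg hε.le hs.1
        have h1 : 1 ≤ (x s) ^ 2 + (y s) ^ 2 := by
          linarith
        have h2 := hg0 s hs.1
        exact mul_nonpos_of_nonneg_of_nonpos (by positivity)
          (mul_nonpos_of_nonneg_of_nonpos (by positivity) (by linarith)))
      (Set.right_mem_Icc.2 ht)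
    linarith
  have hs : ∀ a : ℝ, a ^ 2 ≤ max 1 ((x 0) ^ 2 + (y 0) ^ 2) →
      |a| ≤ max 1 (Real.sqrt ((x 0) ^ 2 + (y 0) ^ 2)) := by
    intro a ha
    rcases le_max_iff.1 ha with h | h
    · exact le_max_of_le_left ((sq_le_one_iff_abs_le_one a).1 h)
    · exact le_max_of_le_right (Real.abs_le_sqrt h)
  exact ⟨key, fun t ht => hs _ (by nlinarith [key t ht, sq_nonneg (y t)]),
    fun t ht => hs _ (by nlinarith [key t ht, sq_nonneg (x t)])⟩
end

section
/- Let g : [0,∞) → ℝ be continuous with g(t) ≥ c for all t ≥ 0, where c > 0, and let x, y : [0,∞) → ℝ be differentiable functions satisfying ẋ(t) = g(t)(x(t) − y(t) − x(t)(x(t)² + y(t)²)) and ẏ(t) = g(t)(x(t) + y(t) − y(t)(x(t)² + y(t)²)) for all t ≥ 0. If x(0)² + y(0)² > 0, then x(t)² + y(t)² → 1 as t → ∞. -/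
lemma lin_sol (a u : ℝ → ℝ) (ha : ContinuousOn a (Set.Ici 0))
    (hu : ∀ t ≥ (0:ℝ), HasDerivWithinAt u (a t * u t) (Set.Ici 0) t) :
    ∀ t ≥ (0:ℝ), u t = u 0 * Real.exp (∫ s in (0:ℝ)..t, a (max s 0)) := by
  have hb : Continuous (fun s : ℝ => a (max s 0)) :=
    ha.comp_continuous (by fun_prop) (fun s => le_max_right s 0)
  intro t ht
  have hd : ∀ s ≥ (0:ℝ), HasDerivWithinAt
      (fun s => u s * Real.exp (-(∫ r in (0:ℝ)..s, a (max r 0)))) 0 (Set.Ici 0) s := by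
    intro s hs
    have h1 : HasDerivAt (fun s => ∫ r in (0:ℝ)..s, a (max r 0)) (a (max s 0)) s :=
      intervalIntegral.integral_hasDerivAt_right (hb.intervalIntegrable _ _)
        (hb.stronglyMeasurableAtFilter _ _) hb.continuousAt
    rw [max_eq_left hs] at h1
    have h2 := (hu s hs).mul h1.neg.exp.hasDerivWithinAt
    refine h2.congr_deriv ?_
    simp only [Pi.neg_apply]
    ring
  have h3 := constant_of_has_deriv_right_zero (a := 0) (b := t)
    (f := fun s => u s * Real.exp (-(∫ r in (0:ℝ)..s, a (max r 0))))
    (fun s hs => ((hd s hs.1).continuousWithinAt).mono Set.Icc_subset_Ici_self)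
    (fun s hs => (hd s hs.1).mono (Set.Ici_subset_Ici.2 hs.1)) t ⟨ht, le_rfl⟩
  simp only [intervalIntegral.integral_same, neg_zero, Real.exp_zero, mul_one] at h3
  rw [← h3, mul_assoc, ← Real.exp_add]
  simp

/-- Global attractivity of the unit circle (Step 3 of the proof of Theorem 1)
for the perturbed planar oscillator with phase rate `g(t) ≥ c > 0`: for any
initial condition other than the origin, `x(t)² + y(t)² → 1` as `t → ∞`. -/
theorem oscillator_circle_attracting
    (g x y : ℝ → ℝ) (c : ℝ) (hc : 0 < c)
    (hg : ContinuousOn g (Set.Ici 0))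
    (hgc : ∀ t ≥ (0:ℝ), c ≤ g t)
    (hx : ∀ t ≥ (0:ℝ), HasDerivWithinAt x
      (g t * (x t - y t - x t * ((x t) ^ 2 + (y t) ^ 2))) (Set.Ici 0) t)
    (hy : ∀ t ≥ (0:ℝ), HasDerivWithinAt y
      (g t * (x t + y t - y t * ((x t) ^ 2 + (y t) ^ 2))) (Set.Ici 0) t)
    (h0 : 0 < (x 0) ^ 2 + (y 0) ^ 2) :
    Filter.Tendsto (fun t => (x t) ^ 2 + (y t) ^ 2) Filter.atTop (nhds 1) := by
  have hv : ∀ t ≥ (0:ℝ), HasDerivWithinAt (fun t => (x t) ^ 2 + (y t) ^ 2)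
      ((2 * g t * (1 - ((x t) ^ 2 + (y t) ^ 2))) * ((x t) ^ 2 + (y t) ^ 2)) (Set.Ici 0) t := by
    intro t ht
    refine (((hx t ht).pow 2).add ((hy t ht).pow 2)).congr_deriv ?_
    push_cast
    ring
  generalize hV : (fun t => (x t) ^ 2 + (y t) ^ 2) = v at *
  have hvt : ∀ t, (x t) ^ 2 + (y t) ^ 2 = v t := fun t => by rw [← hV]
  simp only [hvt] at hv h0
  have hvc : ContinuousOn v (Set.Ici 0) := fun t ht => (hv t ht).continuousWithinAt
  have hpos : ∀ t ≥ (0:ℝ), 0 < v t := by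
    intro t ht
    rw [lin_sol (fun t => 2 * g t * (1 - v t)) v (by fun_prop) hv t ht]
    positivity
  have hw := lin_sol (fun t => -2 * g t) (fun t => (v t)⁻¹ - 1) (by fun_prop) (by
    intro t ht
    have hne := (hpos t ht).ne'
    refine (((hv t ht).inv hne).sub_const 1).congr_deriv ?_
    field_simp)
  have hlin : Filter.Tendsto (fun t : ℝ => (-2 * c) * t) Filter.atTop Filter.atBot :=
    Filter.tendsto_id.const_mul_atTop_of_neg (by linarith)
  have hint : Filter.Tendsto (fun t : ℝ => ∫ s in (0:ℝ)..t, -2 * g (max s 0))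
      Filter.atTop Filter.atBot := by
    refine Filter.tendsto_atBot_mono' _ ?_ hlin
    filter_upwards [Filter.eventually_ge_atTop 0] with t ht
    have hb : Continuous (fun s : ℝ => g (max s 0)) :=
      hg.comp_continuous (by fun_prop) (fun s => le_max_right s 0)
    have := intervalIntegral.integral_mono_on (μ := MeasureTheory.volume) (f := fun s => -2 * g (max s 0))
      (g := fun _ => -2 * c) ht
      ((continuous_const.mul hb).intervalIntegrable (μ := MeasureTheory.volume) 0 t :
        IntervalIntegrable (fun s => -2 * g (max s 0)) _ 0 t)
      (continuous_const.intervalIntegrable 0 t : IntervalIntegrable (fun _ => -2 * c) _ 0 t)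
      (fun s _ => by linarith [hgc (max s 0) (le_max_right s 0)])
    rw [intervalIntegral.integral_const] at this
    simp only [sub_zero, smul_eq_mul] at this
    linarith
  have h1 := (((Real.tendsto_exp_atBot.comp hint).const_mul ((v 0)⁻¹ - 1)).add_const 1).inv₀
    (by norm_num)
  simp only [mul_zero, zero_add, inv_one] at h1
  refine h1.congr' ?_
  filter_upwards [Filter.eventually_ge_atTop 0] with t ht
  have := hw t ht
  simp only [Function.comp]
  rw [← this]
  simp
end

section
/- Let D > 0, T > 0, ρ₀ > 0, and let u : [0,∞) → ℝ be differentiable with |u̇(t)| ≤ D for all t ≥ 0. Suppose that for every t ≥ 0 there exists t' ∈ [t, t+T] with |u(t')| ≥ ρ₀. Then with L = T + ρ₀/D, for every t ≥ 0: ∫_t^{t+L} |u(τ)| dτ ≥ ρ₀²/(2D). -/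
/-- Window-integral lower bound (eq. (38)) from Step 1 of the proof of
Theorem 1: if `u` is differentiable on `[0,∞)` with `|u̇(t)| ≤ D`, and in every
window `[t, t+T]` the function attains `|u(t')| ≥ ρ₀`, then with
`L = T + ρ₀/D` one has `∫_t^{t+L} |u| ≥ ρ₀²/(2D)` for every `t ≥ 0`. -/
theorem window_integral_lower_bound
    (D T ρ₀ : ℝ) (hD : 0 < D) (hT : 0 < T) (hρ₀ : 0 < ρ₀)
    (u u' : ℝ → ℝ)
    (hud : ∀ t ≥ (0:ℝ), HasDerivWithinAt u (u' t) (Set.Ici 0) t)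
    (hu'b : ∀ t ≥ (0:ℝ), |u' t| ≤ D)
    (hpe : ∀ t ≥ (0:ℝ), ∃ t' ∈ Set.Icc t (t + T), ρ₀ ≤ |u t'|) :
    ∀ t ≥ (0:ℝ), ρ₀ ^ 2 / (2 * D) ≤ ∫ τ in t..(t + (T + ρ₀ / D)), |u τ| := by
  intro t ht
  obtain ⟨s, ⟨hs1, hs2⟩, hs⟩ := hpe t ht
  have hr : 0 < ρ₀ / D := div_pos hρ₀ hD
  have hs0 : 0 ≤ s := le_trans ht hs1
  have hcont : ContinuousOn (fun τ => |u τ|) (Set.Ici 0) :=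
    ContinuousOn.abs (fun x hx => (hud x hx).continuousWithinAt)
  have hint : ∀ a b : ℝ, 0 ≤ a → a ≤ b →
      IntervalIntegrable (fun τ => |u τ|) MeasureTheory.volume a b := by
    intro a b ha hab
    apply ContinuousOn.intervalIntegrable
    rw [Set.uIcc_of_le hab]
    exact hcont.mono (fun x hx => le_trans ha hx.1)
  have hlow : ∀ τ ∈ Set.Icc s (s + ρ₀ / D), ρ₀ - D * (τ - s) ≤ |u τ| := by
    intro τ hτ
    have h := Convex.norm_image_sub_le_of_norm_hasDerivWithin_le (f := u) (f' := u')
      (s := Set.Ici (0:ℝ)) (x := s) (y := τ) (C := D)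
      (fun x hx => hud x hx) (fun x hx => hu'b x hx) (convex_Ici 0) hs0 (le_trans hs0 hτ.1)
    rw [Real.norm_eq_abs, Real.norm_eq_abs, abs_of_nonneg (sub_nonneg.2 hτ.1)] at h
    have h2 := abs_sub_abs_le_abs_sub (u s) (u τ)
    rw [abs_sub_comm] at h2
    linarith
  have hval : ∫ τ in s..(s + ρ₀ / D), (ρ₀ - D * (τ - s)) = ρ₀ ^ 2 / (2 * D) := by
    have h := intervalIntegral.integral_comp_sub_right (a := s) (b := s + ρ₀ / D)
      (fun x => ρ₀ - D * x) s
    rw [h, intervalIntegral.integral_sub (by simp)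
      (Continuous.intervalIntegrable (by fun_prop) _ _), intervalIntegral.integral_const_mul,
      integral_id, intervalIntegral.integral_const]
    simp only [smul_eq_mul]
    field_simp
    ring
  calc ρ₀ ^ 2 / (2 * D) = ∫ τ in s..(s + ρ₀ / D), (ρ₀ - D * (τ - s)) := hval.symm
    _ ≤ ∫ τ in s..(s + ρ₀ / D), |u τ| :=
      intervalIntegral.integral_mono_on (by linarith)
        (Continuous.intervalIntegrable (by fun_prop) _ _) (hint _ _ hs0 (by linarith)) hlow
    _ ≤ ∫ τ in t..(t + (T + ρ₀ / D)), |u τ| :=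
      intervalIntegral.integral_mono_interval hs1 (by linarith) (by linarith)
        (Filter.Eventually.of_forall fun x => abs_nonneg _) (hint _ _ ht (by linarith))
end

section
/- Let φ : ℝ → ℝ be continuously differentiable with φ(0) = 0 and φ'(s) ≥ m > 0 for all s ∈ ℝ, and let f : [0,∞) → ℝ be continuous with |f(t)| ≤ F for all t ≥ 0. Let s : [0,∞) → ℝ be a differentiable function satisfying ṡ(t) = −φ(s(t)) + f(t) for all t ≥ 0. Then for all t ≥ 0: |s(t)| ≤ |s(0)| + F/m. -/
/-- Boundedness estimate (eq. (45), first line) for the filter subsystem of the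
structurally stable convergence prototype: if `φ` is `C¹` with `φ(0) = 0` and
`φ'(s) ≥ m > 0`, `f` is continuous with `|f(t)| ≤ F`, and
`ṡ = -φ(s) + f(t)` on `[0,∞)`, then `|s(t)| ≤ |s(0)| + F/m` for all `t ≥ 0`. -/
theorem filter_bounded
    (φ f s : ℝ → ℝ) (m F : ℝ) (hm : 0 < m)
    (hφC1 : ContDiff ℝ 1 φ) (hφ0 : φ 0 = 0)
    (hφ' : ∀ z : ℝ, m ≤ deriv φ z)
    (hfc : ContinuousOn f (Set.Ici 0))
    (hfb : ∀ t ≥ (0:ℝ), |f t| ≤ F)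
    (hs : ∀ t ≥ (0:ℝ), HasDerivWithinAt s (-(φ (s t)) + f t) (Set.Ici 0) t) :
    ∀ t ≥ (0:ℝ), |s t| ≤ |s 0| + F / m := by
  intro t ht
  have hd : Differentiable ℝ φ := hφC1.differentiable (by norm_num)
  have hF : 0 ≤ F := (abs_nonneg _).trans (hfb 0 le_rfl)
  have hFm : 0 ≤ F / m := div_nonneg hF hm.le
  have hcont : ContinuousOn s (Set.Icc 0 t) := fun x hx =>
    ((hs x hx.1).continuousWithinAt).mono Set.Icc_subset_Ici_self
  have hder : ∀ x ∈ Set.Ico 0 t, HasDerivWithinAt s (-(φ (s x)) + f x) (Set.Ici x) x :=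
    fun x hx => (hs x hx.1).mono (Set.Ici_subset_Ici.2 hx.1)
  apply le_of_forall_pos_le_add
  intro ε hε
  have hM0 : 0 < |s 0| + F / m + ε := by positivity
  have hMF : F < m * (|s 0| + F / m + ε) := by
    have h1 : m * (F / m) = F := by field_simp
    have h2 : 0 ≤ m * |s 0| := by positivity
    have h3 : 0 < m * ε := by positivity
    linarith
  have h0 : |s 0| ≤ |s 0| + F / m + ε := by linarith
  generalize |s 0| + F / m + ε = M at hM0 hMF h0 ⊢
  rw [abs_le] at h0 ⊢
  constructor
  · have := image_le_of_deriv_right_lt_deriv_boundary (f := fun x => -s x)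
      (f' := fun x => -(-(φ (s x)) + f x)) (B := fun _ => M) (B' := fun _ => 0)
      hcont.neg (fun x hx => (hder x hx).fun_neg) (by linarith [h0.1])
      (fun x => hasDerivAt_const x M) (by
        intro x hx hxM
        have hxM' : s x = -M := by
          have : -s x = M := hxM
          linarith
        have h1 := mul_sub_le_image_sub_of_le_deriv hd hφ' (x := -M) (y := 0) (by linarith)
        have h2 := (abs_le.1 (hfb x hx.1)).1
        simp only [hxM']
        linarith) (Set.right_mem_Icc.2 ht)
    linarith
  · exact image_le_of_deriv_right_lt_deriv_boundary (f := s)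
      (f' := fun x => (-(φ (s x)) + f x)) (B := fun _ => M) (B' := fun _ => 0)
      hcont hder h0.2
      (fun x => hasDerivAt_const x M) (by
        intro x hx hxM
        have hxM' : s x = M := hxM
        have h1 := mul_sub_le_image_sub_of_le_deriv hd hφ' (x := 0) (y := M) hM0.le
        have h2 := (abs_le.1 (hfb x hx.1)).2
        simp only [hxM']
        linarith) (Set.right_mem_Icc.2 ht)
end
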